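/- arXiv:2506.17097 — 7 statements merged into one kernel-verified Lean document; each statement's English description precedes it below -/
import Mathlib

section
/- Let ε > 0, a > 0 and ω > 0 be real numbers with ω⁴ + (ε² − 2)ω² + 1 − ε²a² = 0. Then |(1 − ω²)/(εa)| < 1, and for every natural number j, the number τ = (arccos((1 − ω²)/(εa)) + 2jπ)/ω satisfies a·sin(ωτ) = ω and εa·cos(ωτ) = 1 − ω². -/
/-- For `ε > 0`, `a > 0`, `ω > 0` with `ω⁴ + (ε² − 2)ω² + 1 − ε²a² = 0`:
`|(1 − ω²)/(εa)| < 1`, and for every natural number `j`, the delay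
`τ = (arccos((1 − ω²)/(εa)) + 2jπ)/ω` satisfies `a·sin(ωτ) = ω` and
`εa·cos(ωτ) = 1 − ω²`. -/
theorem delay_values_pos_a (ε a ω : ℝ) (hε : 0 < ε) (ha : 0 < a) (hω : 0 < ω)
    (hq : ω ^ 4 + (ε ^ 2 - 2) * ω ^ 2 + 1 - ε ^ 2 * a ^ 2 = 0) :
    |(1 - ω ^ 2) / (ε * a)| < 1 ∧
    ∀ j : ℕ,
      a * Real.sin (ω * ((Real.arccos ((1 - ω ^ 2) / (ε * a)) + 2 * (j : ℝ) * Real.pi) / ω))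
          = ω ∧
      ε * a * Real.cos (ω * ((Real.arccos ((1 - ω ^ 2) / (ε * a)) + 2 * (j : ℝ) * Real.pi) / ω))
          = 1 - ω ^ 2 := by
  have hεa : 0 < ε * a := mul_pos hε ha
  have hsq : 1 - ((1 - ω ^ 2) / (ε * a)) ^ 2 = (ω / a) ^ 2 := by
    field_simp
    linear_combination -hq
  have habs : |(1 - ω ^ 2) / (ε * a)| < 1 := by
    have hpos : 0 < (ω / a) ^ 2 := by positivity
    rw [← sq_lt_one_iff_abs_lt_one]
    linarith
  refine ⟨habs, fun j => ?_⟩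
  obtain ⟨hlo, hhi⟩ := abs_lt.mp habs
  rw [mul_div_cancel₀ _ hω.ne', mul_comm (2 : ℝ) (j : ℝ), mul_assoc (j : ℝ) 2 Real.pi,
    Real.sin_add_nat_mul_two_pi, Real.cos_add_nat_mul_two_pi, Real.sin_arccos,
    Real.cos_arccos hlo.le hhi.le, hsq, Real.sqrt_sq (div_pos hω ha).le]
  exact ⟨mul_div_cancel₀ _ ha.ne', mul_div_cancel₀ _ hεa.ne'⟩
end

section
/- Let ε > 0, a < 0 and ω > 0 be real numbers with ω⁴ + (ε² − 2)ω² + 1 − ε²a² = 0. Then |(1 − ω²)/(εa)| < 1, and for every natural number j, the number τ = (2π − arccos((1 − ω²)/(εa)) + 2jπ)/ω satisfies a·sin(ωτ) = ω and εa·cos(ωτ) = 1 − ω². -/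
/-- For `ε > 0`, `a < 0`, `ω > 0` with `ω⁴ + (ε² − 2)ω² + 1 − ε²a² = 0`:
`|(1 − ω²)/(εa)| < 1`, and for every natural number `j`, the delay
`τ = (2π − arccos((1 − ω²)/(εa)) + 2jπ)/ω` satisfies `a·sin(ωτ) = ω` and
`εa·cos(ωτ) = 1 − ω²`. -/
theorem delay_values_neg_a (ε a ω : ℝ) (hε : 0 < ε) (ha : a < 0) (hω : 0 < ω)
    (hq : ω ^ 4 + (ε ^ 2 - 2) * ω ^ 2 + 1 - ε ^ 2 * a ^ 2 = 0) :
    |(1 - ω ^ 2) / (ε * a)| < 1 ∧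
    ∀ j : ℕ,
      a * Real.sin (ω * ((2 * Real.pi - Real.arccos ((1 - ω ^ 2) / (ε * a))
          + 2 * (j : ℝ) * Real.pi) / ω)) = ω ∧
      ε * a * Real.cos (ω * ((2 * Real.pi - Real.arccos ((1 - ω ^ 2) / (ε * a))
          + 2 * (j : ℝ) * Real.pi) / ω)) = 1 - ω ^ 2 := by
  have ha0 : a ≠ 0 := ha.ne
  have hne : ε * a ≠ 0 := mul_ne_zero hε.ne' ha0
  set c := (1 - ω ^ 2) / (ε * a) with hc
  have hmul : ε * a * c = 1 - ω ^ 2 := mul_div_cancel₀ _ hne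
  have hsq : 1 - c ^ 2 = (ω / -a) ^ 2 := by
    rw [hc]
    field_simp
    linear_combination -hq
  have hpos : 0 < ω / -a := div_pos hω (neg_pos.2 ha)
  have habs : |c| < 1 := by
    rw [← sq_lt_one_iff_abs_lt_one]
    nlinarith [pow_pos hpos 2]
  refine ⟨habs, fun j => ?_⟩
  have hangle : ω * ((2 * Real.pi - Real.arccos c + 2 * (j : ℝ) * Real.pi) / ω)
      = -Real.arccos c + ((j + 1 : ℕ) : ℝ) * (2 * Real.pi) := by
    rw [mul_div_cancel₀ _ hω.ne']
    push_cast
    ring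
  rw [hangle, Real.sin_add_nat_mul_two_pi, Real.cos_add_nat_mul_two_pi, Real.sin_neg,
    Real.cos_neg, Real.sin_arccos, Real.cos_arccos (abs_lt.1 habs).1.le (abs_lt.1 habs).2.le,
    hsq, Real.sqrt_sq hpos.le]
  refine ⟨?_, hmul⟩
  field_simp
end

section
/- Assume 0 < ε < √2, ε|a| < 1 and ε² + 4a² > 4, and let ω₁ > ω₂ > 0 be given by ω_{1,2} = ((2 − ε² ± ε√(ε² − 4 + 4a²))/2)^{1/2}. Suppose τ₀ ∈ ℝ satisfies ωᵢ = a·sin(ωᵢτ₀) and 1 − ωᵢ² = εa·cos(ωᵢτ₀) for i = 1, 2. Then the characteristic function h(λ) = λ² − ελ − εa·e^{−λτ₀} + 1 vanishes at the four pairwise distinct points iω₁, −iω₁, iω₂, −iω₂, and each of them is a simple zero of h, i.e. the derivative h′(λ) = 2λ − ε + ετ₀a·e^{−λτ₀} is nonzero at each of these points. -/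
/-- `ω₁ = ((2 − ε² + ε√(ε² − 4 + 4a²))/2)^{1/2}`. -/
noncomputable def om1 (ε a : ℝ) : ℝ :=
  Real.sqrt ((2 - ε ^ 2 + ε * Real.sqrt (ε ^ 2 - 4 + 4 * a ^ 2)) / 2)

/-- `ω₂ = ((2 − ε² − ε√(ε² − 4 + 4a²))/2)^{1/2}`. -/
noncomputable def om2 (ε a : ℝ) : ℝ :=
  Real.sqrt ((2 - ε ^ 2 - ε * Real.sqrt (ε ^ 2 - 4 + 4 * a ^ 2)) / 2)

/-- The characteristic function `h(λ) = λ² − ελ − εa·e^{−λτ} + 1`. -/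
noncomputable def charFn (ε a τ : ℝ) (z : ℂ) : ℂ :=
  z ^ 2 - (ε : ℂ) * z - (ε : ℂ) * (a : ℂ) * Complex.exp (-z * (τ : ℂ)) + 1

/-- The derivative `h′(λ) = 2λ − ε + ετa·e^{−λτ}` of the characteristic function. -/
noncomputable def charFn' (ε a τ : ℝ) (z : ℂ) : ℂ :=
  2 * z - (ε : ℂ) + (ε : ℂ) * (τ : ℂ) * (a : ℂ) * Complex.exp (-z * (τ : ℂ))

theorem exp_neg_I_mul_mul (w τ : ℝ) :
    Complex.exp (-(Complex.I * (w : ℂ)) * (τ : ℂ)) =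
      (Real.cos (w * τ) : ℂ) - (Real.sin (w * τ) : ℂ) * Complex.I := by
  have h : -(Complex.I * (w : ℂ)) * (τ : ℂ) = (-(w * τ) : ℝ) * Complex.I := by
    push_cast
    ring
  rw [h, Complex.exp_mul_I, ← Complex.ofReal_cos, ← Complex.ofReal_sin, Real.cos_neg,
    Real.sin_neg]
  push_cast
  ring

theorem charFn_I_mul_eq_zero {ε a τ w : ℝ} (hs : w = a * Real.sin (w * τ))
    (hc : 1 - w ^ 2 = ε * a * Real.cos (w * τ)) :
    charFn ε a τ (Complex.I * (w : ℂ)) = 0 := by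
  have hs' : (w : ℂ) = a * (Real.sin (w * τ) : ℂ) := by exact_mod_cast hs
  have hc' : 1 - (w : ℂ) ^ 2 = ε * a * (Real.cos (w * τ) : ℂ) := by exact_mod_cast hc
  rw [charFn, exp_neg_I_mul_mul]
  linear_combination hc' - Complex.I * ε * hs' + (w : ℂ) ^ 2 * Complex.I_sq

theorem charFn'_I_mul_ne_zero {ε a τ w : ℝ} (hs : w = a * Real.sin (w * τ))
    (hc : 1 - w ^ 2 = ε * a * Real.cos (w * τ)) (hw : w ≠ 0) (hw2 : 2 * w ^ 2 ≠ 2 - ε ^ 2) :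
    charFn' ε a τ (Complex.I * (w : ℂ)) ≠ 0 := by
  intro h
  have hs' : (w : ℂ) = a * (Real.sin (w * τ) : ℂ) := by exact_mod_cast hs
  have hc' : 1 - (w : ℂ) ^ 2 = ε * a * (Real.cos (w * τ) : ℂ) := by exact_mod_cast hc
  have key : ((τ * (1 - w ^ 2) - ε : ℝ) : ℂ) + ((w * (2 - ε * τ) : ℝ) : ℂ) * Complex.I = 0 := by
    rw [charFn', exp_neg_I_mul_mul] at h
    push_cast at h ⊢
    push_cast at hs' hc'
    linear_combination h + τ * hc' - ε * τ * Complex.I * hs'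
  have hre := congrArg Complex.re key
  have him := congrArg Complex.im key
  simp only [Complex.add_re, Complex.add_im, Complex.ofReal_re, Complex.ofReal_im,
    Complex.re_ofReal_mul, Complex.im_ofReal_mul, Complex.I_re, Complex.I_im, Complex.zero_re,
    Complex.zero_im, mul_zero, mul_one, add_zero, zero_add] at hre him
  have hτ : 2 - ε * τ = 0 := (mul_eq_zero.mp him).resolve_left hw
  exact hw2 (by linear_combination (w ^ 2 - 1) * hτ - ε * hre)

theorem I_mul_ofReal_ne {x y : ℝ} (h : x ≠ y) :
    Complex.I * (x : ℂ) ≠ Complex.I * (y : ℂ) := fun h' =>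
  h (Complex.ofReal_injective (mul_left_cancel₀ Complex.I_ne_zero h'))

theorem om2_radicand_pos {ε a : ℝ} (h1 : 0 < ε) (h2 : ε < Real.sqrt 2) (h3 : ε * |a| < 1) :
    0 < (2 - ε ^ 2 - ε * Real.sqrt (ε ^ 2 - 4 + 4 * a ^ 2)) / 2 := by
  have hε : ε ^ 2 < 2 := (Real.lt_sqrt h1.le).mp h2
  have ha : ε ^ 2 * a ^ 2 < 1 := by
    rw [← sq_abs a, ← mul_pow]
    exact pow_lt_one₀ (by positivity) h3 two_ne_zero
  have hlt : Real.sqrt (ε ^ 2 * (ε ^ 2 - 4 + 4 * a ^ 2)) < 2 - ε ^ 2 :=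
    (Real.sqrt_lt' (by linarith)).mpr (by linarith)
  rw [Real.sqrt_mul (sq_nonneg ε), Real.sqrt_sq h1.le] at hlt
  linarith

/-- Lemma 2.1: at a double Hopf point `(ε, τ₀)` satisfying (H0), the characteristic
equation has the four pairwise distinct simple purely imaginary roots `±iω₁`, `±iω₂`. -/
theorem double_hopf_simple_imaginary_roots (ε a τ₀ : ℝ)
    (h1 : 0 < ε) (h2 : ε < Real.sqrt 2) (h3 : ε * |a| < 1) (h4 : 4 < ε ^ 2 + 4 * a ^ 2)
    (hs1 : om1 ε a = a * Real.sin (om1 ε a * τ₀))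
    (hc1 : 1 - (om1 ε a) ^ 2 = ε * a * Real.cos (om1 ε a * τ₀))
    (hs2 : om2 ε a = a * Real.sin (om2 ε a * τ₀))
    (hc2 : 1 - (om2 ε a) ^ 2 = ε * a * Real.cos (om2 ε a * τ₀)) :
    (charFn ε a τ₀ (Complex.I * (om1 ε a : ℂ)) = 0 ∧
     charFn ε a τ₀ (-(Complex.I * (om1 ε a : ℂ))) = 0 ∧
     charFn ε a τ₀ (Complex.I * (om2 ε a : ℂ)) = 0 ∧
     charFn ε a τ₀ (-(Complex.I * (om2 ε a : ℂ))) = 0) ∧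
    (Complex.I * (om1 ε a : ℂ) ≠ -(Complex.I * (om1 ε a : ℂ)) ∧
     Complex.I * (om1 ε a : ℂ) ≠ Complex.I * (om2 ε a : ℂ) ∧
     Complex.I * (om1 ε a : ℂ) ≠ -(Complex.I * (om2 ε a : ℂ)) ∧
     -(Complex.I * (om1 ε a : ℂ)) ≠ Complex.I * (om2 ε a : ℂ) ∧
     -(Complex.I * (om1 ε a : ℂ)) ≠ -(Complex.I * (om2 ε a : ℂ)) ∧
     Complex.I * (om2 ε a : ℂ) ≠ -(Complex.I * (om2 ε a : ℂ))) ∧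
    (charFn' ε a τ₀ (Complex.I * (om1 ε a : ℂ)) ≠ 0 ∧
     charFn' ε a τ₀ (-(Complex.I * (om1 ε a : ℂ))) ≠ 0 ∧
     charFn' ε a τ₀ (Complex.I * (om2 ε a : ℂ)) ≠ 0 ∧
     charFn' ε a τ₀ (-(Complex.I * (om2 ε a : ℂ))) ≠ 0) := by
  have hr : 0 < ε * Real.sqrt (ε ^ 2 - 4 + 4 * a ^ 2) :=
    mul_pos h1 (Real.sqrt_pos.mpr (by linarith))
  have hp2 := om2_radicand_pos h1 h2 h3
  have hsq1 : om1 ε a ^ 2 = (2 - ε ^ 2 + ε * Real.sqrt (ε ^ 2 - 4 + 4 * a ^ 2)) / 2 :=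
    Real.sq_sqrt (by linarith)
  have hsq2 : om2 ε a ^ 2 = (2 - ε ^ 2 - ε * Real.sqrt (ε ^ 2 - 4 + 4 * a ^ 2)) / 2 :=
    Real.sq_sqrt hp2.le
  have hpos2 : 0 < om2 ε a := Real.sqrt_pos.mpr hp2
  have hlt : om2 ε a < om1 ε a := Real.sqrt_lt_sqrt hp2.le (by linarith)
  have hn1 : 2 * om1 ε a ^ 2 ≠ 2 - ε ^ 2 := by
    rw [hsq1]
    linarith
  have hn2 : 2 * om2 ε a ^ 2 ≠ 2 - ε ^ 2 := by
    rw [hsq2]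
    linarith
  generalize om1 ε a = w₁ at *
  generalize om2 ε a = w₂ at *
  have neg_sin : ∀ {w : ℝ}, w = a * Real.sin (w * τ₀) → -w = a * Real.sin (-w * τ₀) := by
    intro w h
    rw [neg_mul, Real.sin_neg, mul_neg, ← h]
  have neg_cos : ∀ {w : ℝ}, 1 - w ^ 2 = ε * a * Real.cos (w * τ₀) →
      1 - (-w) ^ 2 = ε * a * Real.cos (-w * τ₀) := by
    intro w h
    rw [neg_mul, Real.cos_neg, neg_sq, h]
  simp only [← mul_neg, ← Complex.ofReal_neg]
  refine ⟨⟨charFn_I_mul_eq_zero hs1 hc1, charFn_I_mul_eq_zero (neg_sin hs1) (neg_cos hc1),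
      charFn_I_mul_eq_zero hs2 hc2, charFn_I_mul_eq_zero (neg_sin hs2) (neg_cos hc2)⟩,
    ⟨I_mul_ofReal_ne ?_, I_mul_ofReal_ne ?_, I_mul_ofReal_ne ?_, I_mul_ofReal_ne ?_,
      I_mul_ofReal_ne ?_, I_mul_ofReal_ne ?_⟩,
    charFn'_I_mul_ne_zero hs1 hc1 ?_ hn1,
    charFn'_I_mul_ne_zero (neg_sin hs1) (neg_cos hc1) ?_ (by rwa [neg_sq]),
    charFn'_I_mul_ne_zero hs2 hc2 ?_ hn2,
    charFn'_I_mul_ne_zero (neg_sin hs2) (neg_cos hc2) ?_ (by rwa [neg_sq])⟩ <;>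
  intro h <;> linarith
end

section
/- Assume 0 < ε < √2, ε|a| < 1 and ε² + 4a² > 4. Let τ, ω be real numbers with ω > 0, ω = a·sin(ωτ) and 1 − ω² = εa·cos(ωτ), and let h(λ) = λ² − ελ − εa·e^{−λτ} + 1. Then h′(iω) = (τ(1 − ω²) − ε) + iω(2 − ετ), and h′(iω) ≠ 0. -/
/-- Under (H0), at a purely imaginary characteristic root `iω` one has
`h′(iω) = (τ(1 − ω²) − ε) + iω(2 − ετ) ≠ 0`, i.e. `iω` is a simple root. -/
theorem char_root_is_simple (ε a τ ω : ℝ)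
    (h1 : 0 < ε) (h2 : ε < Real.sqrt 2) (h3 : ε * |a| < 1) (h4 : 4 < ε ^ 2 + 4 * a ^ 2)
    (hω : 0 < ω)
    (hs : ω = a * Real.sin (ω * τ))
    (hc : 1 - ω ^ 2 = ε * a * Real.cos (ω * τ)) :
    charFn' ε a τ (Complex.I * (ω : ℂ))
        = ((τ * (1 - ω ^ 2) - ε : ℝ) : ℂ) + Complex.I * (ω : ℂ) * ((2 - ε * τ : ℝ) : ℂ) ∧
    charFn' ε a τ (Complex.I * (ω : ℂ)) ≠ 0 := by
  have key : charFn' ε a τ (Complex.I * (ω : ℂ))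
      = ((τ * (1 - ω ^ 2) - ε : ℝ) : ℂ) + Complex.I * (ω : ℂ) * ((2 - ε * τ : ℝ) : ℂ) := by
    have hexp : Complex.exp (-(Complex.I * (ω : ℂ)) * (τ : ℂ))
        = (Real.cos (ω * τ) : ℂ) - (Real.sin (ω * τ) : ℂ) * Complex.I := by
      rw [show -(Complex.I * (ω : ℂ)) * (τ : ℂ) = (-((ω * τ : ℝ) : ℂ)) * Complex.I by
        push_cast; ring, Complex.exp_mul_I, Complex.cos_neg, Complex.sin_neg,
        Complex.ofReal_cos, Complex.ofReal_sin]
      ring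
    have hs' : (ω : ℂ) = a * (Real.sin (ω * τ) : ℂ) := by exact_mod_cast hs
    have hc' : 1 - (ω : ℂ) ^ 2 = ε * a * (Real.cos (ω * τ) : ℂ) := by exact_mod_cast hc
    rw [charFn', hexp]
    simp only [Complex.ofReal_sub, Complex.ofReal_mul, Complex.ofReal_pow, Complex.ofReal_one,
      Complex.ofReal_ofNat]
    linear_combination (-(τ : ℂ)) * hc' + ε * τ * Complex.I * hs'
  refine ⟨key, fun h0 => ?_⟩
  rw [key] at h0
  have hre : τ * (1 - ω ^ 2) - ε = 0 := by
    simpa [-Complex.ofReal_sub, -Complex.ofReal_mul] using congrArg Complex.re h0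
  have him : ω = 0 ∨ 2 - ε * τ = 0 := by
    simpa [-Complex.ofReal_sub, -Complex.ofReal_mul] using congrArg Complex.im h0
  have hτ : ε * τ = 2 := by linarith [him.resolve_left hω.ne']
  have hω2 : 2 * (1 - ω ^ 2) = ε ^ 2 := by
    linear_combination ε * hre - (1 - ω ^ 2) * hτ
  have hmod : ε ^ 2 * ω ^ 2 + (1 - ω ^ 2) ^ 2 = ε ^ 2 * a ^ 2 := by
    rw [hc]
    nth_rewrite 1 [hs]
    linear_combination ε ^ 2 * a ^ 2 * Real.sin_sq_add_cos_sq (ω * τ)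
  have hcrit : ε ^ 2 * (ε ^ 2 + 4 * a ^ 2 - 4) = 0 := by
    linear_combination -4 * hmod + (2 * (1 - ω ^ 2) - ε ^ 2) * hω2
  have hpos : 0 < ε ^ 2 * (ε ^ 2 + 4 * a ^ 2 - 4) :=
    mul_pos (pow_pos h1 2) (by linarith)
  exact hpos.ne' hcrit
end

section
/- Let a, τ be real numbers and let ω₁ > ω₂ > 0 satisfy ωᵢ = a·sin(ωᵢτ) for i = 1, 2. Then for all integers k, l with 1 ≤ |k| + |l| ≤ 4, one has k·ω₁ ≠ l·ω₂. -/
/-- If `ω = a sin (ω τ)` is nonzero, then `2ω` is not a solution of the same equation. -/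
theorem two_mul_ne_mul_sin {a τ ω : ℝ} (hω : ω ≠ 0) (h : ω = a * Real.sin (ω * τ)) :
    2 * ω ≠ a * Real.sin (2 * ω * τ) := by
  intro h'
  rw [mul_assoc, Real.sin_two_mul] at h'
  have hcos : Real.cos (ω * τ) = 1 := by
    apply mul_left_cancel₀ hω
    linear_combination Real.cos (ω * τ) * h - h' / 2
  have hsin : Real.sin (ω * τ) = 0 := by
    have := Real.sin_sq_add_cos_sq (ω * τ)
    rw [hcos] at this
    exact pow_eq_zero_iff two_ne_zero |>.mp (by linarith)
  exact hω (by rw [h, hsin, mul_zero])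

/-- If `ω = a sin (ω τ)` is nonzero, then `3ω` is not a solution of the same equation. -/
theorem three_mul_ne_mul_sin {a τ ω : ℝ} (hω : ω ≠ 0) (h : ω = a * Real.sin (ω * τ)) :
    3 * ω ≠ a * Real.sin (3 * ω * τ) := by
  intro h'
  rw [mul_assoc 3 ω τ, Real.sin_three_mul] at h'
  have hsin : Real.sin (ω * τ) = 0 := by
    have : ω * Real.sin (ω * τ) ^ 2 = 0 := by
      linear_combination (Real.sin (ω * τ) ^ 2 - 3 / 4) * h + h' / 4
    exact pow_eq_zero_iff two_ne_zero |>.mp ((mul_eq_zero.mp this).resolve_left hω)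
  exact hω (by rw [h, hsin, mul_zero])

/-- Lemma 2.2: if `ω₁ > ω₂ > 0` satisfy `ωᵢ = a·sin(ωᵢτ)` for `i = 1, 2`, then
`k·ω₁ ≠ l·ω₂` for all integers `k`, `l` with `1 ≤ |k| + |l| ≤ 4`. -/
theorem nonresonance_up_to_order_four (a τ ω₁ ω₂ : ℝ)
    (h21 : ω₂ < ω₁) (h2 : 0 < ω₂)
    (hs1 : ω₁ = a * Real.sin (ω₁ * τ))
    (hs2 : ω₂ = a * Real.sin (ω₂ * τ)) :
    ∀ k l : ℤ, 1 ≤ |k| + |l| → |k| + |l| ≤ 4 → (k : ℝ) * ω₁ ≠ (l : ℝ) * ω₂ := by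
  have hne2 : ω₁ ≠ 2 * ω₂ := fun h ↦
    two_mul_ne_mul_sin h2.ne' hs2 (h ▸ hs1)
  have hne3 : ω₁ ≠ 3 * ω₂ := fun h ↦
    three_mul_ne_mul_sin h2.ne' hs2 (h ▸ hs1)
  intro k l hpos hle heq
  have hk := abs_le.mp (show |k| ≤ 4 by linarith [abs_nonneg l])
  have hl := abs_le.mp (show |l| ≤ 4 by linarith [abs_nonneg k])
  obtain ⟨hk₁, hk₂⟩ := hk
  obtain ⟨hl₁, hl₂⟩ := hl
  interval_cases k <;> interval_cases l <;> push_cast at heq <;>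
    first
    | exact absurd hle (by decide)
    | exact absurd hpos (by decide)
    | linarith
    | exact hne2 (by linarith)
    | exact hne3 (by linarith)
end

section
/- Let δ₁, δ₂, γ, σ be real numbers with γσ > 1, and suppose both components of E₃ = ((δ₁ − γδ₂)/(γσ − 1), (σδ₁ − δ₂)/(γσ − 1)) are positive. Then the characteristic polynomial of the Jacobian matrix of the system η̇₁ = 2η₁(δ₁ + η₁ − γη₂), η̇₂ = 2η₂(δ₂ + ση₁ − η₂) at E₃ is λ² + 2(E₃₂ − E₃₁)λ + 4E₃₁E₃₂(γσ − 1). Moreover, both eigenvalues of this Jacobian have negative real part if and only if (1 − γ)δ₂ < (σ − 1)δ₁, and both have positive real part if and only if (1 − γ)δ₂ > (σ − 1)δ₁. -/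
theorem forall_root_re_neg_iff {b c : ℝ} (hc : 0 < c) :
    (∀ z : ℂ, z ^ 2 + b * z + c = 0 → z.re < 0) ↔ 0 < b := by
  constructor
  · intro H
    obtain ⟨s, hs⟩ := IsAlgClosed.exists_eq_mul_self ((b : ℂ) ^ 2 - 4 * c)
    have h₁ := H ((-b + s) / 2) (by linear_combination -hs / 4)
    have h₂ := H (-b - (-b + s) / 2) (by linear_combination -hs / 4)
    simp only [Complex.sub_re, Complex.neg_re, Complex.ofReal_re] at h₂
    linarith
  · intro hb z hz
    have hre := congrArg Complex.re hz
    have him := congrArg Complex.im hz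
    simp only [pow_two, Complex.add_re, Complex.mul_re, Complex.ofReal_re, Complex.ofReal_im,
      Complex.zero_re, Complex.add_im, Complex.mul_im, Complex.zero_im] at hre him
    have hprod : z.im * (2 * z.re + b) = 0 := by linear_combination him
    rcases mul_eq_zero.mp hprod with hy | hx
    · rw [hy] at hre
      by_contra! hz0
      nlinarith [mul_nonneg hb.le hz0, mul_self_nonneg z.re]
    · linarith

theorem forall_root_re_pos_iff {b c : ℝ} (hc : 0 < c) :
    (∀ z : ℂ, z ^ 2 + b * z + c = 0 → 0 < z.re) ↔ b < 0 := by
  rw [← neg_pos, ← forall_root_re_neg_iff (b := -b) hc]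
  constructor
  · intro H z hz
    have := H (-z) (by push_cast at hz; linear_combination hz)
    rwa [Complex.neg_re, neg_pos] at this
  · intro H z hz
    have := H (-z) (by push_cast; linear_combination hz)
    rwa [Complex.neg_re, neg_lt_zero] at this

theorem hasDerivAt_mul_affine (k a m x : ℝ) :
    HasDerivAt (fun t => k * t * (a + m * t)) (k * (a + 2 * m * x)) x := by
  have h := ((hasDerivAt_id x).const_mul k).mul (((hasDerivAt_id x).const_mul m).const_add a)
  refine h.congr_deriv ?_
  simp only [id]
  ring

theorem hasDerivAt_affine (k a m x : ℝ) :
    HasDerivAt (fun t => k * (a + m * t)) (k * m) x := by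
  simpa using (((hasDerivAt_id x).const_mul m).const_add a).const_mul k

/-- In the difficult case, the characteristic polynomial of the Jacobian of
`η̇₁ = 2η₁(δ₁ + η₁ − γη₂)`, `η̇₂ = 2η₂(δ₂ + ση₁ − η₂)` at the interior equilibrium
`E₃ = ((δ₁ − γδ₂)/(γσ − 1), (σδ₁ − δ₂)/(γσ − 1))` is
`λ² + 2(E₃₂ − E₃₁)λ + 4E₃₁E₃₂(γσ − 1)`; both eigenvalues have negative (resp.
positive) real part iff `(1 − γ)δ₂ < (σ − 1)δ₁` (resp. `>`). -/
theorem E3_stability_difficult_case (δ₁ δ₂ γ σ : ℝ) (h : 1 < γ * σ)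
    (E₁ E₂ : ℝ)
    (hE₁ : E₁ = (δ₁ - γ * δ₂) / (γ * σ - 1))
    (hE₂ : E₂ = (σ * δ₁ - δ₂) / (γ * σ - 1))
    (hE₁pos : 0 < E₁) (hE₂pos : 0 < E₂) :
    (∀ lam : ℝ,
      (Matrix.charpoly
        !![deriv (fun x => 2 * x * (δ₁ + x - γ * E₂)) E₁,
           deriv (fun y => 2 * E₁ * (δ₁ + E₁ - γ * y)) E₂;
           deriv (fun x => 2 * E₂ * (δ₂ + σ * x - E₂)) E₁,
           deriv (fun y => 2 * y * (δ₂ + σ * E₁ - y)) E₂]).eval lam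
        = lam ^ 2 + 2 * (E₂ - E₁) * lam + 4 * E₁ * E₂ * (γ * σ - 1)) ∧
    ((∀ μ : ℂ, μ ^ 2 + 2 * ((E₂ : ℂ) - (E₁ : ℂ)) * μ
          + 4 * (E₁ : ℂ) * (E₂ : ℂ) * ((γ : ℂ) * (σ : ℂ) - 1) = 0 → μ.re < 0)
      ↔ (1 - γ) * δ₂ < (σ - 1) * δ₁) ∧
    ((∀ μ : ℂ, μ ^ 2 + 2 * ((E₂ : ℂ) - (E₁ : ℂ)) * μ
          + 4 * (E₁ : ℂ) * (E₂ : ℂ) * ((γ : ℂ) * (σ : ℂ) - 1) = 0 → 0 < μ.re)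
      ↔ (σ - 1) * δ₁ < (1 - γ) * δ₂) := by
  have hD : 0 < γ * σ - 1 := by linarith
  have hc : 0 < 4 * E₁ * E₂ * (γ * σ - 1) := by positivity
  have e₁ : E₁ * (γ * σ - 1) = δ₁ - γ * δ₂ := by rw [hE₁, div_mul_cancel₀ _ hD.ne']
  have e₂ : E₂ * (γ * σ - 1) = σ * δ₁ - δ₂ := by rw [hE₂, div_mul_cancel₀ _ hD.ne']
  have q₁ : δ₁ + E₁ - γ * E₂ = 0 := by
    apply mul_right_cancel₀ hD.ne'
    linear_combination e₁ - γ * e₂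
  have q₂ : δ₂ + σ * E₁ - E₂ = 0 := by
    apply mul_right_cancel₀ hD.ne'
    linear_combination σ * e₁ - e₂
  have hdiff : (E₂ - E₁) * (γ * σ - 1) = (σ - 1) * δ₁ - (1 - γ) * δ₂ := by
    linear_combination e₂ - e₁
  have hb_pos : 0 < 2 * (E₂ - E₁) ↔ (1 - γ) * δ₂ < (σ - 1) * δ₁ := by
    rw [← sub_pos (b := (1 - γ) * δ₂), ← hdiff, mul_pos_iff_of_pos_right hD,
      mul_pos_iff_of_pos_left two_pos]
  have hb_neg : 2 * (E₂ - E₁) < 0 ↔ (σ - 1) * δ₁ < (1 - γ) * δ₂ := by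
    rw [← sub_neg (b := (1 - γ) * δ₂), ← hdiff, ← neg_pos (a := (E₂ - E₁) * _), ← neg_mul,
      mul_pos_iff_of_pos_right hD, neg_pos, ← neg_pos, ← mul_neg,
      mul_pos_iff_of_pos_left two_pos, neg_pos]
  refine ⟨fun lam => ?_, ?_, ?_⟩
  · have d₁₁ : deriv (fun x => 2 * x * (δ₁ + x - γ * E₂)) E₁ = 2 * E₁ := by
      have h := (hasDerivAt_mul_affine 2 (δ₁ - γ * E₂) 1 E₁).deriv
      rw [show (fun x => 2 * x * (δ₁ + x - γ * E₂)) =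
        fun x => 2 * x * (δ₁ - γ * E₂ + 1 * x) from funext fun x => by ring, h]
      linear_combination 2 * q₁
    have d₁₂ : deriv (fun y => 2 * E₁ * (δ₁ + E₁ - γ * y)) E₂ = -2 * γ * E₁ := by
      have h := (hasDerivAt_affine (2 * E₁) (δ₁ + E₁) (-γ) E₂).deriv
      rw [show (fun y => 2 * E₁ * (δ₁ + E₁ - γ * y)) =
        fun y => 2 * E₁ * (δ₁ + E₁ + -γ * y) from funext fun y => by ring, h]
      ring
    have d₂₁ : deriv (fun x => 2 * E₂ * (δ₂ + σ * x - E₂)) E₁ = 2 * σ * E₂ := by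
      have h := (hasDerivAt_affine (2 * E₂) (δ₂ - E₂) σ E₁).deriv
      rw [show (fun x => 2 * E₂ * (δ₂ + σ * x - E₂)) =
        fun x => 2 * E₂ * (δ₂ - E₂ + σ * x) from funext fun x => by ring, h]
      ring
    have d₂₂ : deriv (fun y => 2 * y * (δ₂ + σ * E₁ - y)) E₂ = -2 * E₂ := by
      have h := (hasDerivAt_mul_affine 2 (δ₂ + σ * E₁) (-1) E₂).deriv
      rw [show (fun y => 2 * y * (δ₂ + σ * E₁ - y)) =
        fun y => 2 * y * (δ₂ + σ * E₁ + -1 * y) from funext fun y => by ring, h]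
      linear_combination 2 * q₂
    rw [d₁₁, d₁₂, d₂₁, d₂₂, Matrix.charpoly_fin_two, Matrix.trace_fin_two_of,
      Matrix.det_fin_two_of]
    simp only [Polynomial.eval_add, Polynomial.eval_sub, Polynomial.eval_mul,
      Polynomial.eval_pow, Polynomial.eval_X, Polynomial.eval_C]
    ring
  · rw [← hb_pos, ← forall_root_re_neg_iff hc]
    push_cast
    rfl
  · rw [← hb_neg, ← forall_root_re_pos_iff hc]
    push_cast
    rfl
end

section
/- Let δ₁, δ₂, γ, σ be real numbers with γσ > 1, suppose both components of E₃ = ((δ₁ − γδ₂)/(γσ − 1), (σδ₁ − δ₂)/(γσ − 1)) are positive, and suppose (1 − γ)δ₂ = (σ − 1)δ₁. Then E₃₁ = E₃₂, and the Jacobian matrix of the system η̇₁ = 2η₁(δ₁ + η₁ − γη₂), η̇₂ = 2η₂(δ₂ + ση₁ − η₂) at E₃ has trace zero, determinant 4E₃₁E₃₂(γσ − 1) > 0, and hence its eigenvalues form the purely imaginary conjugate pair ±2i√(E₃₁E₃₂(γσ − 1)). -/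
/-- The slope at `a` of a product of two affine functions on `ℝ`. -/
theorem deriv_affine_mul_affine (p q r s a : ℝ) :
    deriv (fun x => (p * x + q) * (r * x + s)) a = p * (r * a + s) + (p * a + q) * r := by
  have hf : HasDerivAt (fun x : ℝ => p * x + q) p a := by
    simpa using ((hasDerivAt_id a).const_mul p).add_const q
  have hg : HasDerivAt (fun x : ℝ => r * x + s) r a := by
    simpa using ((hasDerivAt_id a).const_mul r).add_const s
  exact (hf.mul hg).deriv

/-- The complex roots of `z ^ 2 + 4 * d` for `d ≥ 0` form a purely imaginary pair. -/
theorem Complex.sq_add_four_mul_ofReal_eq_zero_iff {d : ℝ} (hd : 0 ≤ d) (z : ℂ) :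
    z ^ 2 + ((4 * d : ℝ) : ℂ) = 0 ↔
      z = 2 * Complex.I * (Real.sqrt d : ℝ) ∨ z = -(2 * Complex.I * (Real.sqrt d : ℝ)) := by
  have hs : ((Real.sqrt d : ℝ) : ℂ) ^ 2 = d := by
    exact_mod_cast Real.sq_sqrt hd
  rw [← sq_eq_sq_iff_eq_or_eq_neg, mul_pow, mul_pow, Complex.I_sq, hs, ← sub_eq_zero (a := z ^ 2)]
  push_cast
  ring_nf

/-- On the secondary Hopf curve `(1 − γ)δ₂ = (σ − 1)δ₁`, the interior equilibrium
`E₃` of `η̇₁ = 2η₁(δ₁ + η₁ − γη₂)`, `η̇₂ = 2η₂(δ₂ + ση₁ − η₂)` has `E₃₁ = E₃₂`,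
the Jacobian there has trace zero and determinant `4E₃₁E₃₂(γσ − 1) > 0`, and its
eigenvalues form the purely imaginary pair `±2i√(E₃₁E₃₂(γσ − 1))`. -/
theorem E3_hopf_purely_imaginary (δ₁ δ₂ γ σ : ℝ) (h : 1 < γ * σ)
    (E₁ E₂ : ℝ)
    (hE₁ : E₁ = (δ₁ - γ * δ₂) / (γ * σ - 1))
    (hE₂ : E₂ = (σ * δ₁ - δ₂) / (γ * σ - 1))
    (hE₁pos : 0 < E₁) (hE₂pos : 0 < E₂)
    (hH : (1 - γ) * δ₂ = (σ - 1) * δ₁) :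
    E₁ = E₂ ∧
    Matrix.trace
        !![deriv (fun x => 2 * x * (δ₁ + x - γ * E₂)) E₁,
           deriv (fun y => 2 * E₁ * (δ₁ + E₁ - γ * y)) E₂;
           deriv (fun x => 2 * E₂ * (δ₂ + σ * x - E₂)) E₁,
           deriv (fun y => 2 * y * (δ₂ + σ * E₁ - y)) E₂] = 0 ∧
    Matrix.det
        !![deriv (fun x => 2 * x * (δ₁ + x - γ * E₂)) E₁,
           deriv (fun y => 2 * E₁ * (δ₁ + E₁ - γ * y)) E₂;
           deriv (fun x => 2 * E₂ * (δ₂ + σ * x - E₂)) E₁,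
           deriv (fun y => 2 * y * (δ₂ + σ * E₁ - y)) E₂]
      = 4 * E₁ * E₂ * (γ * σ - 1) ∧
    0 < 4 * E₁ * E₂ * (γ * σ - 1) ∧
    ∀ μ : ℂ,
      (μ ^ 2
          - (Matrix.trace
              !![deriv (fun x => 2 * x * (δ₁ + x - γ * E₂)) E₁,
                 deriv (fun y => 2 * E₁ * (δ₁ + E₁ - γ * y)) E₂;
                 deriv (fun x => 2 * E₂ * (δ₂ + σ * x - E₂)) E₁,
                 deriv (fun y => 2 * y * (δ₂ + σ * E₁ - y)) E₂] : ℝ) * μ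
          + ((4 * E₁ * E₂ * (γ * σ - 1) : ℝ) : ℂ) = 0)
        ↔ (μ = 2 * Complex.I * (Real.sqrt (E₁ * E₂ * (γ * σ - 1)) : ℝ) ∨
           μ = -(2 * Complex.I * (Real.sqrt (E₁ * E₂ * (γ * σ - 1)) : ℝ))) := by
  have hne : γ * σ - 1 ≠ 0 := by linarith
  have hpos : 0 < γ * σ - 1 := by linarith
  have hE : E₁ = E₂ := by
    rw [hE₁, hE₂]
    congr 1
    linarith
  rw [eq_div_iff hne] at hE₁ hE₂
  have hnull₁ : δ₁ + E₁ - γ * E₂ = 0 := by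
    apply mul_right_cancel₀ hne
    linear_combination hE₁ - γ * hE₂
  have hnull₂ : δ₂ + σ * E₁ - E₂ = 0 := by
    apply mul_right_cancel₀ hne
    linear_combination σ * hE₁ - hE₂
  have h₁₁ : deriv (fun x => 2 * x * (δ₁ + x - γ * E₂)) E₁ = 2 * E₁ := by
    convert deriv_affine_mul_affine 2 0 1 (δ₁ - γ * E₂) E₁ using 1
    · congr 1
      ext x
      ring
    · linear_combination -2 * hnull₁
  have h₁₂ : deriv (fun y => 2 * E₁ * (δ₁ + E₁ - γ * y)) E₂ = -(2 * γ * E₁) := by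
    convert deriv_affine_mul_affine 0 (2 * E₁) (-γ) (δ₁ + E₁) E₂ using 1
    · congr 1
      ext y
      ring
    · ring
  have h₂₁ : deriv (fun x => 2 * E₂ * (δ₂ + σ * x - E₂)) E₁ = 2 * σ * E₂ := by
    convert deriv_affine_mul_affine 0 (2 * E₂) σ (δ₂ - E₂) E₁ using 1
    · congr 1
      ext x
      ring
    · ring
  have h₂₂ : deriv (fun y => 2 * y * (δ₂ + σ * E₁ - y)) E₂ = -(2 * E₂) := by
    convert deriv_affine_mul_affine 2 0 (-1) (δ₂ + σ * E₁) E₂ using 1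
    · congr 1
      ext y
      ring
    · linear_combination -2 * hnull₂
  rw [h₁₁, h₁₂, h₂₁, h₂₂]
  have htrace : Matrix.trace !![2 * E₁, -(2 * γ * E₁); 2 * σ * E₂, -(2 * E₂)] = 0 := by
    rw [Matrix.trace_fin_two_of, hE]
    ring
  refine ⟨hE, htrace, ?_, by positivity, fun μ => ?_⟩
  · rw [Matrix.det_fin_two_of]
    ring
  · rw [htrace, Complex.ofReal_zero, zero_mul, sub_zero,
      ← Complex.sq_add_four_mul_ofReal_eq_zero_iff (by positivity)]
    simp only [mul_assoc]
end
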